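/- arXiv:1709.04570 — 3 statements merged into one kernel-verified Lean document; each statement's English description precedes it below -/
import Mathlib

section
/- Let Z be a finite type, T a natural number, and z : ℕ → Z a sequence. For each y ∈ Z and each time t ≥ 1, let N_t(y) = |{τ : 1 ≤ τ < t, z_τ = y}| be the number of indices τ < t with z_τ = y. Then ∑_{t=1}^{T} 1/√(max(1, N_t(z_t))) ≤ 3 ∑_{y ∈ Z} √(N_{T+1}(y)). -/
lemma step_aux (n : ℕ) :
    1 / Real.sqrt (max 1 (n : ℝ)) ≤ 3 * (Real.sqrt ((n + 1 : ℕ) : ℝ) - Real.sqrt (n : ℝ)) := by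
  rcases Nat.eq_zero_or_pos n with h | h
  · subst h
    norm_num
  · have h1 : (1 : ℝ) ≤ n := by exact_mod_cast h
    rw [max_eq_right h1]
    have ha : 1 ≤ Real.sqrt n := Real.one_le_sqrt.mpr h1
    have hs : Real.sqrt n ^ 2 = n := Real.sq_sqrt (by linarith)
    set a := Real.sqrt (n : ℝ) with hadef
    have hi : 1 / a ≤ 1 := by
      rw [div_le_one (by linarith)]
      exact ha
    have hi0 : 0 ≤ 1 / a := by positivity
    have hm : a * (1 / a) = 1 := by field_simp
    have : a + (1 / a) / 3 ≤ Real.sqrt ((n + 1 : ℕ) : ℝ) := by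
      apply Real.le_sqrt_of_sq_le
      push_cast
      nlinarith
    linarith

/-- For a sequence `z` taking values in a finite type `Z`, with `N t y` the number of
indices `1 ≤ τ < t` with `z τ = y`, we have
`∑_{t=1}^{T} 1/√(max 1 (N t (z t))) ≤ 3 ∑_{y ∈ Z} √(N (T+1) y)`. -/
theorem stmt_8 (Z : Type*) [Fintype Z] [DecidableEq Z] (T : ℕ) (z : ℕ → Z)
    (N : ℕ → Z → ℕ)
    (hN : ∀ t y, N t y = ((Finset.Ico 1 t).filter (fun τ => z τ = y)).card) :
    ∑ t ∈ Finset.Icc 1 T, 1 / Real.sqrt (max 1 (N t (z t)))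
      ≤ 3 * ∑ y : Z, Real.sqrt (N (T + 1) y) := by
  induction T with
  | zero =>
    simp only [Finset.Icc_eq_empty_of_lt Nat.zero_lt_one, Finset.sum_empty]
    positivity
  | succ T ih =>
    rw [Finset.sum_Icc_succ_top (by omega)]
    have hsucc : ∀ y, N (T + 1 + 1) y = N (T + 1) y + if z (T + 1) = y then 1 else 0 := by
      intro y
      rw [hN, hN, ← Finset.insert_Ico_right_eq_Ico_add_one (by omega), Finset.filter_insert]
      split_ifs with h
      · rw [Finset.card_insert_of_notMem (by simp)]
      · rfl
    have key : ∑ y : Z, Real.sqrt (N (T + 1 + 1) y) - ∑ y : Z, Real.sqrt (N (T + 1) y)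
        = Real.sqrt ((N (T + 1) (z (T + 1)) + 1 : ℕ) : ℝ)
          - Real.sqrt (N (T + 1) (z (T + 1))) := by
      rw [← Finset.sum_sub_distrib, Finset.sum_eq_single (z (T + 1))]
      · rw [hsucc, if_pos rfl]
      · intro b _ hb
        rw [hsucc, if_neg (Ne.symm hb)]
        simp
      · simp
    have := step_aux (N (T + 1) (z (T + 1)))
    linarith
end

section
/- Let Z be a finite type of cardinality n, T a natural number, and z : ℕ → Z a sequence. For each y ∈ Z and each time t ≥ 1, let N_t(y) = |{τ : 1 ≤ τ < t, z_τ = y}| be the number of indices τ < t with z_τ = y. Then ∑_{t=1}^{T} 1/√(max(1, N_t(z_t))) ≤ 3 √(n · T). -/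
lemma aux_step (k : ℕ) : 1 / Real.sqrt (max 1 (k : ℝ)) + 3 * Real.sqrt k ≤ 3 * Real.sqrt ((k + 1 : ℕ) : ℝ) := by
  rcases Nat.eq_zero_or_pos k with rfl | hk
  · norm_num
  · have h1 : (1 : ℝ) ≤ k := by exact_mod_cast hk
    rw [max_eq_right h1]
    push_cast
    have ha : 0 < Real.sqrt k := Real.sqrt_pos.mpr (by linarith)
    have ha2 : Real.sqrt k ^ 2 = k := Real.sq_sqrt (by linarith)
    set a := Real.sqrt (k : ℝ) with hadef
    have key : (1 / a + 3 * a) / 3 ≤ Real.sqrt ((k : ℝ) + 1) := by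
      apply Real.le_sqrt_of_sq_le
      have e : ((1 / a + 3 * a) / 3) ^ 2 = (1 / k) / 9 + 2 / 3 + k := by
        rw [← ha2]; field_simp; ring
      rw [e]
      have : (1 : ℝ) / k ≤ 1 := by rw [div_le_one (by linarith)]; exact h1
      linarith
    linarith

lemma aux_sum (Z : Type*) [Fintype Z] [DecidableEq Z] (T : ℕ) (z : ℕ → Z) (N : ℕ → Z → ℕ)
    (hN : ∀ t y, N t y = ((Finset.Ico 1 t).filter (fun τ => z τ = y)).card) :
    ∑ t ∈ Finset.Icc 1 T, 1 / Real.sqrt (max 1 (N t (z t) : ℝ))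
      ≤ ∑ y, 3 * Real.sqrt (N (T + 1) y) := by
  induction T with
  | zero => simp [hN]
  | succ T ih =>
    rw [Finset.sum_Icc_succ_top (by omega)]
    have hs : ∀ y, N (T + 1 + 1) y = N (T + 1) y + if z (T + 1) = y then 1 else 0 := by
      intro y
      rw [hN, hN, ← Finset.insert_Ico_right_eq_Ico_add_one (by omega), Finset.filter_insert]
      split_ifs
      · rw [Finset.card_insert_of_notMem (by simp)]
      · simp
    refine (add_le_add_left ih _).trans ?_
    rw [← Finset.add_sum_erase _ (fun y => 3 * Real.sqrt (N (T + 1) y)) (Finset.mem_univ (z (T + 1))),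
      ← Finset.add_sum_erase _ (fun y => 3 * Real.sqrt (N (T + 1 + 1) y)) (Finset.mem_univ (z (T + 1)))]
    have h2 : ∑ y ∈ Finset.univ.erase (z (T + 1)), 3 * Real.sqrt (N (T + 1 + 1) y)
        = ∑ y ∈ Finset.univ.erase (z (T + 1)), 3 * Real.sqrt (N (T + 1) y) := by
      apply Finset.sum_congr rfl
      intro y hy
      rw [hs, if_neg (fun h => (Finset.ne_of_mem_erase hy) h.symm), add_zero]
    rw [h2, hs (z (T + 1)), if_pos rfl]
    have := aux_step (N (T + 1) (z (T + 1)))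
    linarith

/-- For a sequence `z` taking values in a finite type `Z` of cardinality `n`, with
`N t y` the number of indices `1 ≤ τ < t` with `z τ = y`, we have
`∑_{t=1}^{T} 1/√(max 1 (N t (z t))) ≤ 3 √(n T)`. -/
theorem stmt_10 (Z : Type*) [Fintype Z] [DecidableEq Z] (n : ℕ)
    (hn : Fintype.card Z = n) (T : ℕ) (z : ℕ → Z) (N : ℕ → Z → ℕ)
    (hN : ∀ t y, N t y = ((Finset.Ico 1 t).filter (fun τ => z τ = y)).card) :
    ∑ t ∈ Finset.Icc 1 T, 1 / Real.sqrt (max 1 (N t (z t)))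
      ≤ 3 * Real.sqrt (n * T) := by
  have h := aux_sum Z T z N hN
  refine h.trans ?_
  rw [← Finset.mul_sum]
  refine mul_le_mul_of_nonneg_left ?_ (by norm_num)
  apply Real.le_sqrt_of_sq_le
  refine (sq_sum_le_card_mul_sum_sq).trans ?_
  have hT : ∑ y, N (T + 1) y = T := by
    simp only [hN]
    rw [← Finset.card_eq_sum_card_fiberwise (f := z) (t := Finset.univ) (by intro x _; simp)]
    simp
  have hT' : ∑ y, ((N (T + 1) y : ℕ) : ℝ) = T := by exact_mod_cast hT
  simp only [Real.sq_sqrt (Nat.cast_nonneg _)]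
  rw [hT', Finset.card_univ, hn]
end

section
/- Let K and M ≥ 1 be natural numbers, T ≥ 0 a real number, and T_ : ℕ → ℕ a sequence with T_0 = 1 and T_k ≥ 1 for all 1 ≤ k ≤ K. Suppose ∑_{k=1}^{K} T_k ≤ T and the cardinality of the set {k ∈ {1, …, K} : T_k ≠ T_{k-1} + 1} is at most M − 1. Then (K : ℝ) ≤ √(2 M T). -/
theorem cs_step (A L Q b : ℕ) (h : A ^ 2 ≤ b * Q) :
    (A + L) ^ 2 ≤ (b + 1) * (Q + L ^ 2) := by
  have h2 : 2 * (A * L) ≤ Q + b * L ^ 2 := by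
    refine (Nat.pow_le_pow_iff_left (n := 2) (by norm_num)).1 ?_
    have h3 : A ^ 2 * L ^ 2 ≤ b * Q * L ^ 2 := Nat.mul_le_mul_right _ h
    zify at h3 ⊢
    nlinarith [sq_nonneg ((Q : ℤ) - b * L ^ 2)]
  nlinarith

theorem run_inv (T_ : ℕ → ℕ) (h0 : T_ 0 = 1) (K : ℕ)
    (h1 : ∀ k, 1 ≤ k → k ≤ K → 1 ≤ T_ k) :
    ∃ A L Q : ℕ, K = A + L ∧ L ≤ T_ K ∧
      Q + L * (L + 1) ≤ 2 * ∑ k ∈ Finset.Icc 1 K, T_ k ∧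
      A ^ 2 ≤ ((Finset.Icc 1 K).filter (fun k => T_ k ≠ T_ (k - 1) + 1)).card * Q := by
  induction K with
  | zero => exact ⟨0, 0, 0, by simp⟩
  | succ K ih =>
    obtain ⟨A, L, Q, hK, hL, hS, hA⟩ := ih (fun k a b => h1 k a (by omega))
    have hpos := h1 (K + 1) (by omega) le_rfl
    have hI : Finset.Icc 1 (K + 1) = insert (K + 1) (Finset.Icc 1 K) := by
      ext x; simp only [Finset.mem_Icc, Finset.mem_insert]; omega
    have hn : K + 1 ∉ Finset.Icc 1 K := by simp
    rw [hI, Finset.sum_insert hn, Finset.filter_insert]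
    by_cases hb : T_ (K + 1) = T_ K + 1
    · refine ⟨A, L + 1, Q, by omega, by omega, by nlinarith, ?_⟩
      simpa [hb] using hA
    · refine ⟨A + L, 1, Q + L ^ 2, by omega, hpos, by nlinarith, ?_⟩
      rw [if_pos (by simpa using hb), Finset.card_insert_of_notMem (by simp)]
      exact cs_step _ _ _ _ hA

/-- Bound on the number of episodes: if `T_ 0 = 1`, each `T_ k ≥ 1` for `1 ≤ k ≤ K`,
the total `∑_{k=1}^{K} T_ k` is at most `T`, and the number of indices
`k ∈ {1, …, K}` with `T_ k ≠ T_ (k-1) + 1` is at most `M - 1`, then `K ≤ √(2 M T)`. -/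
theorem stmt_13 (K M : ℕ) (hM : 1 ≤ M) (T : ℝ) (hT : 0 ≤ T) (T_ : ℕ → ℕ)
    (h0 : T_ 0 = 1) (h1 : ∀ k, 1 ≤ k → k ≤ K → 1 ≤ T_ k)
    (hsum : ((∑ k ∈ Finset.Icc 1 K, T_ k : ℕ) : ℝ) ≤ T)
    (hcard : ((Finset.Icc 1 K).filter (fun k => T_ k ≠ T_ (k - 1) + 1)).card ≤ M - 1) :
    (K : ℝ) ≤ Real.sqrt (2 * M * T) := by
  obtain ⟨A, L, Q, hK, -, hS, hA⟩ := run_inv T_ h0 K h1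
  have hc := cs_step A L Q _ hA
  have hN : K ^ 2 ≤ M * (2 * ∑ k ∈ Finset.Icc 1 K, T_ k) := by
    rw [← hK] at hc
    exact hc.trans (Nat.mul_le_mul (by omega) (by nlinarith))
  apply Real.le_sqrt_of_sq_le
  have hR : (K : ℝ) ^ 2 ≤ M * (2 * ((∑ k ∈ Finset.Icc 1 K, T_ k : ℕ) : ℝ)) := by
    exact_mod_cast hN
  have hM0 : (0 : ℝ) ≤ M := Nat.cast_nonneg M
  nlinarith [mul_le_mul_of_nonneg_left hsum hM0]
end
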